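/- arXiv:2504.16567 — 2 statements merged into one kernel-verified Lean document; each statement's English description precedes it below -/
import Mathlib

section
/- For every finite digraph A and all positive integers n and m: hom(A, m·C_n) = 0 if n does not divide γ(A), and hom(A, m·C_n) = (m·n)^{c(A)} if n divides γ(A). -/
/-- A finite digraph: a number of vertices together with an edge relation on `Fin n`. -/
abbrev FinDigraph := Σ n : ℕ, (Fin n → Fin n → Prop)

/-- `f` is a homomorphism of digraphs from `A` to `B`. -/
def IsHom (A B : FinDigraph) (f : Fin A.1 → Fin B.1) : Prop :=
  ∀ a b : Fin A.1, A.2 a b → B.2 (f a) (f b)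

/-- The number of homomorphisms from `A` to `B`. -/
noncomputable def homN (A B : FinDigraph) : ℕ :=
  Nat.card {f : Fin A.1 → Fin B.1 // IsHom A B f}
/-- An oriented walk in a digraph `A`, with `len` steps: vertices `vert 0, …, vert len`
and signs `sign 0, …, sign (len-1)`, where a `true` sign is a forward edge and a
`false` sign is a backward edge. -/
structure OWalk (A : FinDigraph) where
  len : ℕ
  vert : ℕ → Fin A.1
  sign : ℕ → Bool
  valid : ∀ i < len,
    (sign i = true → A.2 (vert i) (vert (i + 1))) ∧
    (sign i = false → A.2 (vert (i + 1)) (vert i))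

/-- The net length of an oriented walk: number of forward steps minus number of
backward steps. -/
def OWalk.netLength {A : FinDigraph} (W : OWalk A) : ℤ :=
  (((Finset.range W.len).filter fun i => W.sign i = true).card : ℤ) -
  (((Finset.range W.len).filter fun i => W.sign i = false).card : ℤ)

/-- An oriented cycle: a closed oriented walk with at least one step whose vertices
(other than the repeated endpoint) are pairwise distinct. -/
def OWalk.IsCycle {A : FinDigraph} (W : OWalk A) : Prop :=
  0 < W.len ∧ W.vert W.len = W.vert 0 ∧
    ∀ i < W.len, ∀ j < W.len, W.vert i = W.vert j → i = j
/-- The gcd of a set of natural numbers: the number dividing all elements of `S`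
that is divisible by every common divisor of `S` (this is `0` when `S ⊆ {0}`). -/
noncomputable def setGcd (S : Set ℕ) : ℕ :=
  sInf {d : ℕ | (∀ s ∈ S, d ∣ s) ∧ ∀ e : ℕ, (∀ s ∈ S, e ∣ s) → e ∣ d}

/-- `gamma A` is the gcd of the net lengths of all oriented cycles of positive net
length in `A` (`0` if there are none). -/
noncomputable def gamma (A : FinDigraph) : ℕ :=
  setGcd {m : ℕ | 0 < m ∧ ∃ W : OWalk A, W.IsCycle ∧ W.netLength = (m : ℤ)}
/-- The directed cycle `C_n` on vertex set `ℤ/nℤ` (represented as `Fin n`),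
with edges `i → i+1 (mod n)`. -/
def cycleD (n : ℕ) : FinDigraph := ⟨n, fun i j => (i.val + 1) % n = j.val⟩
/-- `copies m H` is the disjoint union of `m` copies of the digraph `H`. -/
def copies (m : ℕ) (H : FinDigraph) : FinDigraph :=
  ⟨m * H.1, fun i j =>
    ((finProdFinEquiv (m := m) (n := H.1)).symm i).1 =
      ((finProdFinEquiv (m := m) (n := H.1)).symm j).1 ∧
    H.2 ((finProdFinEquiv (m := m) (n := H.1)).symm i).2
      ((finProdFinEquiv (m := m) (n := H.1)).symm j).2⟩
/-- The number of connected components of a digraph: the number of equivalence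
classes of the equivalence relation generated by the edge relation. -/
noncomputable def comps (A : FinDigraph) : ℕ := Nat.card (Quot A.2)

theorem dvd_setGcd_iff (S : Set ℕ) (n : ℕ) : n ∣ setGcd S ↔ ∀ s ∈ S, n ∣ s := by
  have hne : {d : ℕ | (∀ s ∈ S, d ∣ s) ∧ ∀ e : ℕ, (∀ s ∈ S, e ∣ s) → e ∣ d}.Nonempty :=
    ⟨Nat.setGcd S, fun s hs => Nat.setGcd_dvd_of_mem hs, fun e he => Nat.dvd_setGcd_iff.2 he⟩
  have h := Nat.sInf_mem hne
  exact ⟨fun hd s hs => hd.trans (h.1 s hs), fun hd => h.2 n hd⟩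

def sg (b : Bool) : ℤ := if b then 1 else -1

theorem netLength_eq {A : FinDigraph} (W : OWalk A) :
    W.netLength = ∑ i ∈ Finset.range W.len, sg (W.sign i) := by
  unfold OWalk.netLength
  rw [Finset.card_filter, Finset.card_filter]
  push_cast
  rw [← Finset.sum_sub_distrib]
  apply Finset.sum_congr rfl
  intro i _
  cases W.sign i <;> simp [sg]

theorem hom_dvd {A : FinDigraph} (W : OWalk A) {n : ℕ} (p : Fin A.1 → ZMod n)
    (hp : ∀ a b, A.2 a b → p b = p a + 1) :
    ∀ k ≤ W.len, p (W.vert k) = p (W.vert 0) + ((∑ i ∈ Finset.range k, sg (W.sign i) : ℤ) : ZMod n) := by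
  intro k
  induction k with
  | zero => simp
  | succ k ih =>
    intro hk
    have h1 := ih (by omega)
    have hv := W.valid k (by omega)
    rw [Finset.sum_range_succ]
    push_cast at h1 ⊢
    cases hs : W.sign k with
    | true =>
      rw [hp _ _ (hv.1 hs), h1]; simp [sg, add_assoc]
    | false =>
      have := hp _ _ (hv.2 hs)
      rw [h1] at this
      rw [← add_assoc, this]; simp [sg]

def OWalk.rev {A : FinDigraph} (W : OWalk A) : OWalk A where
  len := W.len
  vert k := W.vert (W.len - k)
  sign k := !W.sign (W.len - 1 - k)
  valid := by
    intro i hi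
    have h := W.valid (W.len - 1 - i) (by omega)
    have e1 : W.len - 1 - i + 1 = W.len - i := by omega
    have e2 : W.len - (i + 1) = W.len - 1 - i := by omega
    rw [e1] at h
    rw [e2]
    constructor
    · intro hs; exact h.2 (by simpa using hs)
    · intro hs; exact h.1 (by simpa using hs)

theorem rev_net {A : FinDigraph} (W : OWalk A) : W.rev.netLength = - W.netLength := by
  rw [netLength_eq, netLength_eq, ← Finset.sum_range_reflect (fun i => sg (W.sign i)),
    ← Finset.sum_neg_distrib]
  apply Finset.sum_congr rfl
  intro i _
  simp only [OWalk.rev]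
  cases W.sign (W.len - 1 - i) <;> simp [sg]

theorem rev_cycle {A : FinDigraph} (W : OWalk A) (h : W.IsCycle) : W.rev.IsCycle := by
  obtain ⟨h0, hc, hi⟩ := h
  refine ⟨h0, ?_, ?_⟩
  · simp [OWalk.rev, hc]
  · intro i hi' j hj' hij
    simp only [OWalk.rev] at hi' hj' hij
    rcases Nat.eq_zero_or_pos i with rfl | hip <;> rcases Nat.eq_zero_or_pos j with rfl | hjp
    · rfl
    · rw [Nat.sub_zero, hc] at hij
      have := hi 0 h0 (W.len - j) (by omega) hij; omega
    · rw [Nat.sub_zero, hc] at hij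
      have := hi (W.len - i) (by omega) 0 h0 hij; omega
    · have := hi (W.len - i) (by omega) (W.len - j) (by omega) hij; omega

theorem cycle_dvd {A : FinDigraph} {n : ℕ} (h : n ∣ gamma A) (W : OWalk A) (hW : W.IsCycle) :
    (n : ℤ) ∣ W.netLength := by
  rw [gamma, dvd_setGcd_iff] at h
  rcases lt_trichotomy W.netLength 0 with h0 | h0 | h0
  · have := h W.rev.netLength.toNat ⟨by rw [rev_net]; omega, W.rev, rev_cycle W hW, by
      rw [rev_net]; omega⟩
    have h2 : (n : ℤ) ∣ (W.rev.netLength.toNat : ℤ) := by exact_mod_cast this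
    rw [rev_net, Int.toNat_of_nonneg (by omega)] at h2
    exact (dvd_neg).1 h2
  · rw [h0]; exact dvd_zero _
  · have := h W.netLength.toNat ⟨by omega, W, hW, by omega⟩
    have h2 : (n : ℤ) ∣ (W.netLength.toNat : ℤ) := by exact_mod_cast this
    rwa [Int.toNat_of_nonneg (by omega)] at h2

theorem closed_dvd {A : FinDigraph} {n : ℕ} (h : n ∣ gamma A) :
    ∀ (L : ℕ) (W : OWalk A), W.len = L → W.vert W.len = W.vert 0 → (n : ℤ) ∣ W.netLength := by
  intro L
  induction L using Nat.strong_induction_on with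
  | _ L ih =>
  intro W hL hc
  rcases Nat.eq_zero_or_pos L with h0 | h0
  · rw [netLength_eq, hL, h0]; simp
  by_cases hinj : ∀ i < W.len, ∀ j < W.len, W.vert i = W.vert j → i = j
  · exact cycle_dvd h W ⟨by omega, hc, hinj⟩
  have : ∃ i d, 0 < d ∧ i + d < W.len ∧ W.vert i = W.vert (i + d) := by
    push Not at hinj
    obtain ⟨i, hi, j, hj, hij, hne⟩ := hinj
    rcases lt_or_gt_of_ne hne with hlt | hlt
    · exact ⟨i, j - i, by omega, by omega, by rw [hij]; congr 1; omega⟩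
    · exact ⟨j, i - j, by omega, by omega, by rw [← hij]; congr 1; omega⟩
  obtain ⟨i, d, hd, hlt, hv⟩ := this
  obtain ⟨r, hr⟩ : ∃ r, W.len = i + d + r := ⟨W.len - (i + d), by omega⟩
  let W1 : OWalk A := ⟨d, fun k => W.vert (i + k), fun k => W.sign (i + k),
    fun k hk => W.valid (i + k) (by omega)⟩
  let W2 : OWalk A := ⟨i + r, fun k => if k ≤ i then W.vert k else W.vert (k + d),
    fun k => if k < i then W.sign k else W.sign (k + d), by
      intro k hk
      rcases lt_trichotomy k i with h1 | h1 | h1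
      · have := W.valid k (by omega)
        simpa [h1, h1.le, Nat.succ_le_of_lt h1] using this
      · subst h1
        have := W.valid (k + d) (by omega)
        rw [← hv] at this
        have e : k + 1 + d = k + d + 1 := by omega
        simpa [e] using this
      · have := W.valid (k + d) (by omega)
        have e : k + 1 + d = k + d + 1 := by omega
        have e1 : ¬ k ≤ i := by omega
        have e2 : ¬ k + 1 ≤ i := by omega
        have e3 : ¬ k < i := by omega
        simpa [e, e1, e2, e3] using this⟩
  have d1 := ih d (by omega) W1 rfl (by simp [W1, hv])
  have d2 := ih (i + r) (by omega) W2 rfl (by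
    have e : ¬ i + r ≤ i := by omega
    have e2 : i + r + d = W.len := by omega
    simp only [W2, if_neg e, e2, hc]; simp)
  have key : W.netLength = W1.netLength + W2.netLength := by
    rw [netLength_eq, netLength_eq, netLength_eq, hr, Finset.sum_range_add, Finset.sum_range_add]
    simp only [W1, W2]
    rw [Finset.sum_range_add]
    have s1 : ∑ k ∈ Finset.range i, sg (if k < i then W.sign k else W.sign (k + d))
        = ∑ k ∈ Finset.range i, sg (W.sign k) := by
      apply Finset.sum_congr rfl
      intro k hk
      rw [if_pos (Finset.mem_range.1 hk)]
    have s2 : ∑ k ∈ Finset.range r, sg (if i + k < i then W.sign (i + k) else W.sign (i + k + d))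
        = ∑ k ∈ Finset.range r, sg (W.sign (i + d + k)) := by
      apply Finset.sum_congr rfl
      intro k hk
      rw [if_neg (by omega), Nat.add_right_comm]
    rw [s1, s2]; ring
  rw [key]; exact dvd_add d1 d2

def Stp (A : FinDigraph) (u v : Fin A.1 × ℤ) : Prop :=
  (A.2 u.1 v.1 ∧ v.2 = u.2 + 1) ∨ (A.2 v.1 u.1 ∧ u.2 = v.2 + 1)

theorem stp_symm (A : FinDigraph) : Std.Symm (Stp A) := ⟨fun _ _ h => h.symm⟩

theorem reach_symm {A : FinDigraph} {u v} (h : Relation.ReflTransGen (Stp A) u v) :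
    Relation.ReflTransGen (Stp A) v u := by
  induction h with
  | refl => exact .refl
  | tail _ h ih => exact .head h.symm ih

theorem reach_walk {A : FinDigraph} {u v} (h : Relation.ReflTransGen (Stp A) u v) :
    ∃ W : OWalk A, W.vert 0 = u.1 ∧ W.vert W.len = v.1 ∧ W.netLength = v.2 - u.2 := by
  induction h with
  | refl => exact ⟨⟨0, fun _ => u.1, fun _ => true, by simp⟩, rfl, rfl, by simp [netLength_eq]⟩
  | @tail v w _ h ih =>
    obtain ⟨W, h0, h1, h2⟩ := ih
    have main : ∀ s : Bool, (s = true → A.2 v.1 w.1) → (s = false → A.2 w.1 v.1) →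
        w.2 = v.2 + sg s →
        ∃ W : OWalk A, W.vert 0 = u.1 ∧ W.vert W.len = w.1 ∧ W.netLength = w.2 - u.2 := by
      intro s hs1 hs2 hw
      refine ⟨⟨W.len + 1, fun k => if k ≤ W.len then W.vert k else w.1,
        fun k => if k < W.len then W.sign k else s, ?_⟩, by simpa using h0, by simp, ?_⟩
      · intro k hk
        rcases Nat.lt_or_ge k W.len with hlt | hge
        · simpa [hlt, hlt.le, Nat.succ_le_of_lt hlt] using W.valid k hlt
        · have : k = W.len := by omega
          subst this
          simpa [h1] using ⟨hs1, hs2⟩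
      · rw [netLength_eq] at h2 ⊢
        simp only
        rw [Finset.sum_range_succ, if_neg (lt_irrefl _)]
        have : ∑ k ∈ Finset.range W.len, sg (if k < W.len then W.sign k else s)
            = ∑ k ∈ Finset.range W.len, sg (W.sign k) :=
          Finset.sum_congr rfl fun k hk => by rw [if_pos (Finset.mem_range.1 hk)]
        rw [this, h2, hw]; ring
    rcases h with ⟨ha, hb⟩ | ⟨ha, hb⟩
    · exact main true (fun _ => ha) (by simp) (by simp [sg, hb])
    · exact main false (by simp) (fun _ => ha) (by simp [sg, hb])

theorem reach_shift {A : FinDigraph} {u v} (c : ℤ) (h : Relation.ReflTransGen (Stp A) u v) :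
    Relation.ReflTransGen (Stp A) (u.1, u.2 + c) (v.1, v.2 + c) := by
  induction h with
  | refl => exact .refl
  | tail _ h ih =>
    refine ih.tail ?_
    rcases h with ⟨ha, hb⟩ | ⟨ha, hb⟩
    · exact Or.inl ⟨ha, by simp only [hb]; ring⟩
    · exact Or.inr ⟨ha, by simp only [hb]; ring⟩

theorem reach_exists {A : FinDigraph} {a b : Fin A.1} (h : Relation.EqvGen A.2 a b) :
    ∃ x : ℤ, Relation.ReflTransGen (Stp A) (a, 0) (b, x) := by
  induction h with
  | rel a b h => exact ⟨1, .single (Or.inl ⟨h, by simp⟩)⟩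
  | refl a => exact ⟨0, .refl⟩
  | symm a b _ ih =>
    obtain ⟨x, hx⟩ := ih
    refine ⟨-x, ?_⟩
    simpa using reach_shift (-x) (reach_symm hx)
  | trans a b c _ _ ih1 ih2 =>
    obtain ⟨x, hx⟩ := ih1
    obtain ⟨y, hy⟩ := ih2
    refine ⟨y + x, hx.trans ?_⟩
    simpa using reach_shift x hy

theorem exists_potential {A : FinDigraph} {n : ℕ} (h : n ∣ gamma A) :
    ∃ p : Fin A.1 → ZMod n, ∀ a b, A.2 a b → p b = p a + 1 := by
  have hr : ∀ a : Fin A.1, ∃ x : ℤ,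
      Relation.ReflTransGen (Stp A) ((Quot.mk A.2 a).out, 0) (a, x) := fun a =>
    reach_exists (Quot.eqvGen_exact (Quot.out_eq _))
  choose x hx using hr
  refine ⟨fun a => (x a : ZMod n), fun a b hab => ?_⟩
  have ha := hx a
  have hb := hx b
  rw [Quot.sound hab] at ha
  have hc := ((reach_symm hb).trans ha).tail (c := (b, x a + 1)) (Or.inl ⟨hab, rfl⟩)
  obtain ⟨W, h0, h1, h2⟩ := reach_walk hc
  have := closed_dvd h _ W rfl (by rw [h0, h1])
  rw [h2] at this
  have := (ZMod.intCast_zmod_eq_zero_iff_dvd _ n).2 this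
  push_cast at this
  exact (sub_eq_zero.1 this).symm

theorem exists_equiv (n m : ℕ) (hn : 0 < n) :
    ∃ e : Fin (copies m (cycleD n)).1 ≃ Fin m × ZMod n, ∀ i j,
      (copies m (cycleD n)).2 i j ↔ ((e j).1 = (e i).1 ∧ (e j).2 = (e i).2 + 1) := by
  obtain ⟨k, rfl⟩ : ∃ k, n = k + 1 := ⟨n - 1, by omega⟩
  refine ⟨(finProdFinEquiv (m := m) (n := k + 1)).symm, fun i j => ?_⟩
  have key : ∀ a b : Fin (k + 1), (a.val + 1) % (k + 1) = b.val ↔ b = a + 1 := by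
    intro a b
    rw [Fin.ext_iff, Fin.val_add, eq_comm]
    simp
  exact and_congr eq_comm (key _ _)

/-- for every finite digraph `A` and positive integers `n, m`,
`hom(A, m·C_n) = 0` if `n ∤ γ(A)`, and `hom(A, m·C_n) = (m·n)^{c(A)}` if `n ∣ γ(A)`. -/
theorem stmt1 (A : FinDigraph) (n m : ℕ) (hn : 0 < n) (hm : 0 < m) :
    (¬ n ∣ gamma A → homN A (copies m (cycleD n)) = 0) ∧
    (n ∣ gamma A → homN A (copies m (cycleD n)) = (m * n) ^ comps A) := by
  obtain ⟨e, he⟩ := exists_equiv n m hn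
  constructor
  · intro h
    unfold homN
    rw [Nat.card_eq_zero]
    left
    refine ⟨fun ⟨f, hf⟩ => h ?_⟩
    rw [gamma, dvd_setGcd_iff]
    rintro s ⟨_, W, hW, hs⟩
    have := hom_dvd W (fun a => (e (f a)).2) (fun a b hab => ((he _ _).1 (hf a b hab)).2) W.len le_rfl
    rw [hW.2.1, ← netLength_eq, hs] at this
    have h0 : ((s : ℕ) : ZMod n) = 0 := by simpa using this
    exact (ZMod.natCast_eq_zero_iff s n).1 h0
  · intro h
    obtain ⟨p, hp⟩ := exists_potential h
    haveI : NeZero n := ⟨hn.ne'⟩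
    let E : {f : Fin A.1 → Fin (copies m (cycleD n)).1 // IsHom A (copies m (cycleD n)) f} ≃
        (Quot A.2 → Fin m × ZMod n) :=
      { toFun := fun f => Quot.lift (fun a => ((e (f.1 a)).1, (e (f.1 a)).2 - p a)) (by
          intro a b hab
          have := (he _ _).1 (f.2 a b hab)
          simp only [this.1, this.2, hp a b hab]
          simp)
        invFun := fun g => ⟨fun a => e.symm ((g (Quot.mk _ a)).1, (g (Quot.mk _ a)).2 + p a), by
          intro a b hab
          rw [he]
          simp [Quot.sound hab, hp a b hab, add_assoc]⟩
        left_inv := by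
          intro f
          apply Subtype.ext
          funext a
          simp
        right_inv := by
          intro g
          funext q
          induction q using Quot.ind
          simp }
    unfold homN comps
    rw [Nat.card_congr E, Nat.card_fun]
    simp
end

section
/- For all positive integers n and k, the class D_n := {2^{n−m}·C_{2^m} : 0 ≤ m ≤ n, m even} (taken up to isomorphism) can be separated from the class D_n' := {2^{n−m}·C_{2^m} : 0 ≤ m ≤ n, m odd} (taken up to isomorphism) by an adaptive left k-query algorithm over ℕ if and only if 2^k ≥ n + 1 (equivalently, k ≥ log₂(n+1)). -/
/-- Isomorphism of digraphs. -/
def Iso (A B : FinDigraph) : Prop :=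
  ∃ e : Fin A.1 ≃ Fin B.1, ∀ a b : Fin A.1, A.2 a b ↔ B.2 (e a) (e b)
/-- The class `D_n` of digraphs isomorphic to `2^(n-m)·C_{2^m}` for some even `m ≤ n`. -/
def Dn (n : ℕ) : Set FinDigraph :=
  {A | ∃ m ≤ n, Even m ∧ Iso A (copies (2 ^ (n - m)) (cycleD (2 ^ m)))}

/-- The class `D_n'` of digraphs isomorphic to `2^(n-m)·C_{2^m}` for some odd `m ≤ n`. -/
def Dn' (n : ℕ) : Set FinDigraph :=
  {A | ∃ m ≤ n, Odd m ∧ Iso A (copies (2 ^ (n - m)) (cycleD (2 ^ m)))}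
/-- The run of an adaptive left query algorithm over ℕ given by query function
`G` (mapping the list of previous answers to the next queried digraph) on input `A`:
`advRunN G A k` is the list of the first `k` answers. -/
noncomputable def advRunN (G : List ℕ → FinDigraph) (A : FinDigraph) : ℕ → List ℕ
  | 0 => []
  | j + 1 => advRunN G A j ++ [homN (G (advRunN G A j)) A]

/-- Functions constant along edges. -/
noncomputable def constN (G : FinDigraph) (s : ℕ) : ℕ :=
  Nat.card {g : Fin G.1 → Fin s // ∀ a b, G.2 a b → g a = g b}

def CycHom (G : FinDigraph) (N : ℕ) : Prop := ∃ h, IsHom G (cycleD N) h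

lemma cyc_edge (N : ℕ) [NeZero N] (i j : Fin N) : (i.val + 1) % N = j.val ↔ i + 1 = j := by
  rw [Fin.ext_iff, Fin.val_add, Fin.val_one', Nat.add_mod_mod]

lemma homN_of_cyc (G : FinDigraph) (r N : ℕ) [NeZero N] (hc : CycHom G N) :
    homN G (copies r (cycleD N)) = constN G (r * N) := by
  obtain ⟨h, hh⟩ := hc
  change Fin G.1 → Fin N at h
  have hh' : ∀ a b, G.2 a b → h a + 1 = h b := fun a b hab =>
    (cyc_edge N _ _).1 (hh a b hab)
  let e : Fin (r * N) ≃ Fin r × Fin N := finProdFinEquiv.symm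
  have key : ∀ f : Fin G.1 → Fin (r * N), IsHom G (copies r (cycleD N)) f ↔
      ∀ a b, G.2 a b → (e (f a)).1 = (e (f b)).1 ∧ (e (f a)).2 + 1 = (e (f b)).2 := by
    intro f
    constructor
    · intro hf a b hab
      exact ⟨(hf a b hab).1, (cyc_edge N _ _).1 (hf a b hab).2⟩
    · intro hf a b hab
      exact ⟨(hf a b hab).1, (cyc_edge N _ _).2 (hf a b hab).2⟩
  let E : (Fin G.1 → Fin (r * N)) ≃ (Fin G.1 → Fin (r * N)) :=
    { toFun := fun f v => e.symm ((e (f v)).1, (e (f v)).2 - h v)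
      invFun := fun f v => e.symm ((e (f v)).1, (e (f v)).2 + h v)
      left_inv := fun f => by funext v; simp
      right_inv := fun f => by funext v; simp }
  refine Nat.card_congr (Equiv.subtypeEquiv E ?_)
  intro f
  refine (key f).trans ?_
  refine forall_congr' fun a => forall_congr' fun b => forall_congr' fun hab => ?_
  change _ ↔ e.symm ((e (f a)).1, (e (f a)).2 - h a) = e.symm ((e (f b)).1, (e (f b)).2 - h b)
  rw [e.symm.apply_eq_iff_eq, Prod.mk.injEq]
  refine and_congr_right fun _ => ?_
  rw [← hh' a b hab, sub_eq_sub_iff_add_eq_add]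
  constructor
  · intro h1; rw [← h1]; abel
  · intro h1
    have : (e (f a)).2 + 1 + h a = (e (f b)).2 + h a := by rw [← h1]; abel
    exact add_right_cancel this

lemma homN_of_not_cyc (G : FinDigraph) (r N : ℕ) (hc : ¬ CycHom G N) :
    homN G (copies r (cycleD N)) = 0 := by
  have : IsEmpty {f : Fin G.1 → Fin (copies r (cycleD N)).1 // IsHom G (copies r (cycleD N)) f} := by
    constructor
    rintro ⟨f, hf⟩
    exact hc ⟨fun v => ((finProdFinEquiv (m := r) (n := N)).symm (f v)).2,
      fun a b hab => (hf a b hab).2⟩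
  exact Nat.card_of_isEmpty

lemma constN_ne (G : FinDigraph) (s : ℕ) (hs : 0 < s) : constN G s ≠ 0 := by
  have : Nonempty {g : Fin G.1 → Fin s // ∀ a b, G.2 a b → g a = g b} :=
    ⟨⟨fun _ => ⟨0, hs⟩, fun _ _ _ => rfl⟩⟩
  exact Nat.card_pos.ne'

lemma cycHom_dvd (G : FinDigraph) (N M : ℕ) (hM : 0 < M) (hd : M ∣ N) (hc : CycHom G N) :
    CycHom G M := by
  obtain ⟨h, hh⟩ := hc
  change Fin G.1 → Fin N at h
  refine ⟨fun v => (⟨(h v).val % M, Nat.mod_lt _ hM⟩ : Fin M), fun a b hab => ?_⟩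
  have h1 : ((h a).val + 1) % N = (h b).val := hh a b hab
  change ((h a).val % M + 1) % M = (h b).val % M
  rw [← h1, Nat.mod_mod_of_dvd _ hd, Nat.mod_add_mod]

lemma cycHom_cycle (N M : ℕ) (hN : 0 < N) (hM : 0 < M) : CycHom (cycleD N) M ↔ M ∣ N := by
  constructor
  · rintro ⟨f, hf⟩
    change Fin N → Fin M at f
    have hf' : ∀ i j : Fin N, (i.val + 1) % N = j.val → ((f i).val + 1) % M = (f j).val := hf
    have key : ∀ i : ℕ, (f ⟨i % N, Nat.mod_lt _ hN⟩).val = ((f ⟨0, hN⟩).val + i) % M := by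
      intro i
      induction i with
      | zero => simp [Nat.mod_eq_of_lt (f ⟨0, hN⟩).isLt]
      | succ i ih =>
        rw [← hf' ⟨i % N, Nat.mod_lt _ hN⟩ ⟨(i + 1) % N, Nat.mod_lt _ hN⟩ (by simp), ih]
        simp [add_assoc]
    have h1 := key N
    simp only [Nat.mod_self] at h1
    have h2 : (f ⟨0, hN⟩).val + 0 ≡ (f ⟨0, hN⟩).val + N [MOD M] := by
      unfold Nat.ModEq
      rw [← h1, add_zero, Nat.mod_eq_of_lt (f ⟨0, hN⟩).isLt]
    exact (Nat.modEq_zero_iff_dvd).1 (Nat.ModEq.add_left_cancel' _ h2).symm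
  · intro hd
    exact cycHom_dvd _ N M hM hd ⟨id, fun a b hab => hab⟩

lemma homN_iso (G A B : FinDigraph) (h : Iso A B) : homN G A = homN G B := by
  obtain ⟨e, he⟩ := h
  refine Nat.card_congr (Equiv.subtypeEquiv (Equiv.arrowCongr (Equiv.refl _) e) ?_)
  intro f
  exact forall_congr' fun a => forall_congr' fun b => forall_congr' fun _ => he _ _

lemma run_iso (G : List ℕ → FinDigraph) (A B : FinDigraph) (h : Iso A B) (j : ℕ) :
    advRunN G A j = advRunN G B j := by
  induction j with
  | zero => rfl
  | succ j ih => simp only [advRunN]; rw [ih, homN_iso _ _ _ h]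

def Am (n m : ℕ) : FinDigraph := copies (2 ^ (n - m)) (cycleD (2 ^ m))

lemma homN_Am (G : FinDigraph) (n m : ℕ) (hm : m ≤ n) (hc : CycHom G (2 ^ m)) :
    homN G (Am n m) = constN G (2 ^ n) := by
  rw [Am, homN_of_cyc _ _ _ hc, ← pow_add, Nat.sub_add_cancel hm]

lemma split_lem (P : ℕ → Prop) (hP : ∀ i j, i ≤ j → P j → P i) (a len : ℕ) :
    ∃ c ≤ len, (∀ i, a ≤ i → i < a + c → P i) ∧ (∀ i, a + c ≤ i → i < a + len → ¬ P i) := by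
  induction len with
  | zero => exact ⟨0, le_rfl, fun i _ _ => by omega, fun i _ _ => by omega⟩
  | succ len ih =>
    by_cases h : P (a + len)
    · exact ⟨len + 1, le_rfl, fun i _ _ => hP i (a + len) (by omega) h, fun i _ _ => by omega⟩
    · obtain ⟨c, hc, h1, h2⟩ := ih
      refine ⟨c, by omega, h1, fun i hi hi' => ?_⟩
      rcases Nat.lt_or_ge i (a + len) with h3 | h3
      · exact h2 i hi h3
      · rwa [show i = a + len by omega]

lemma lower (G : List ℕ → FinDigraph) (n j : ℕ) :
    ∃ a len : ℕ, a + len ≤ n + 1 ∧ n + 1 ≤ len * 2 ^ j ∧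
      ∃ l, ∀ m, a ≤ m → m < a + len → advRunN G (Am n m) j = l := by
  induction j with
  | zero => exact ⟨0, n + 1, by omega, by simp, [], fun _ _ _ => rfl⟩
  | succ j ih =>
    obtain ⟨a, len, h1, h2, l, hl⟩ := ih
    obtain ⟨c, hc, hp, hq⟩ := split_lem (fun m => CycHom (G l) (2 ^ m))
      (fun i j hij h => cycHom_dvd _ _ _ (by positivity) (pow_dvd_pow 2 hij) h) a len
    rw [pow_succ]
    by_cases hcc : len ≤ 2 * c
    · refine ⟨a, c, by omega, ?_, l ++ [constN (G l) (2 ^ n)], fun m hm hm' => ?_⟩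
      · nlinarith [Nat.mul_le_mul_right (2 ^ j) hcc]
      · rw [advRunN, hl m hm (by omega), homN_Am _ _ _ (by omega) (hp m hm hm')]
    · refine ⟨a + c, len - c, by omega, ?_, l ++ [0], fun m hm hm' => ?_⟩
      · have : len ≤ 2 * (len - c) := by omega
        nlinarith [Nat.mul_le_mul_right (2 ^ j) this]
      · rw [advRunN, hl m (by omega) (by omega), Am,
          homN_of_not_cyc _ _ _ (hq m hm (by omega))]

lemma Am_iso (n m : ℕ) : Iso (Am n m) (copies (2 ^ (n - m)) (cycleD (2 ^ m))) :=
  ⟨Equiv.refl _, fun _ _ => Iff.rfl⟩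

/-- The number read off from a list of answers. -/
def readN (l : List ℕ) : ℕ := l.foldl (fun p a => 2 * p + if a = 0 then 1 else 0) 0

def qry (k : ℕ) (l : List ℕ) : FinDigraph :=
  cycleD (2 ^ ((2 * readN l + 1) * 2 ^ (k - l.length - 1) - 1))

lemma run_length (G : List ℕ → FinDigraph) (A : FinDigraph) (j : ℕ) :
    (advRunN G A j).length = j := by
  induction j with
  | zero => rfl
  | succ j ih => simp [advRunN, ih]

lemma homN_cycle (n m t : ℕ) (hm : m ≤ n) :
    homN (cycleD (2 ^ t)) (Am n m) = 0 ↔ t < m := by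
  have h := cycHom_cycle (2 ^ t) (2 ^ m) (by positivity) (by positivity)
  rw [Nat.pow_dvd_pow_iff_le_right (by norm_num)] at h
  constructor
  · intro h0
    by_contra hlt
    rw [homN_Am _ _ _ hm (h.2 (by omega))] at h0
    exact constN_ne _ _ (by positivity) h0
  · intro hlt
    exact homN_of_not_cyc _ _ _ (fun hc => by have := h.1 hc; omega)

lemma upper (n k m : ℕ) (hm : m ≤ n) (hk : n + 1 ≤ 2 ^ k) (j : ℕ) (hj : j ≤ k) :
    readN (advRunN (qry k) (Am n m) j) = m / 2 ^ (k - j) := by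
  induction j with
  | zero =>
    have : m / 2 ^ k = 0 := Nat.div_eq_of_lt (by omega)
    simp [advRunN, readN, this]
  | succ j ih =>
    specialize ih (by omega)
    set l := advRunN (qry k) (Am n m) j with hl
    have hlen : l.length = j := run_length _ _ _
    have h1 : readN (advRunN (qry k) (Am n m) (j + 1)) =
        2 * readN l + if homN (qry k l) (Am n m) = 0 then 1 else 0 := by
      rw [advRunN, ← hl]; simp [readN]
    rw [h1, qry, hlen]
    simp only [homN_cycle n m _ hm]
    obtain ⟨d, rfl⟩ : ∃ d, k = j + 1 + d := ⟨k - (j + 1), by omega⟩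
    rw [show j + 1 + d - j = d + 1 by omega] at ih
    rw [show j + 1 + d - j - 1 = d by omega, show j + 1 + d - (j + 1) = d by omega, ih]
    rw [pow_succ, ← Nat.div_div_eq_div_mul]
    set q := m / 2 ^ d with hq
    have hpos : 0 < 2 ^ d := by positivity
    have h2 : (2 * (q / 2) + 1) * 2 ^ d ≤ m ↔ 2 * (q / 2) + 1 ≤ q :=
      (Nat.le_div_iff_mul_le hpos).symm
    have h3 : 0 < (2 * (q / 2) + 1) * 2 ^ d := by positivity
    have h4 : (2 * (q / 2) + 1) * 2 ^ d - 1 < m ↔ 2 * (q / 2) + 1 ≤ q := by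
      rw [← h2]; omega
    simp only [h4]
    split_ifs <;> omega

/-- for positive `n, k`, the classes `D_n` and `D_n'` are separated by an
adaptive left `k`-query algorithm over ℕ if and only if `2^k ≥ n + 1`. -/
theorem stmt4 (n k : ℕ) (hn : 0 < n) (hk : 0 < k) :
    (∃ (G : List ℕ → FinDigraph) (X : Set (List ℕ)),
      (∀ A ∈ Dn n, advRunN G A k ∈ X) ∧
      (∀ B ∈ Dn' n, advRunN G B k ∉ X)) ↔ n + 1 ≤ 2 ^ k := by
  constructor
  · rintro ⟨G, X, hA, hB⟩
    by_contra hlt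
    obtain ⟨a, len, h1, h2, l, hl⟩ := lower G n k
    have hlen : 2 ≤ len := by
      by_contra h
      have : len * 2 ^ k ≤ 1 * 2 ^ k := Nat.mul_le_mul_right _ (by omega)
      omega
    have e1 := hl a le_rfl (by omega)
    have e2 := hl (a + 1) (by omega) (by omega)
    rcases Nat.even_or_odd a with ha | ha
    · have x1 := hA (Am n a) ⟨a, by omega, ha, Am_iso n a⟩
      have x2 := hB (Am n (a + 1)) ⟨a + 1, by omega, ha.add_one, Am_iso n (a + 1)⟩
      rw [e1] at x1; rw [e2] at x2
      exact x2 x1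
    · have x1 := hB (Am n a) ⟨a, by omega, ha, Am_iso n a⟩
      have x2 := hA (Am n (a + 1)) ⟨a + 1, by omega, ha.add_one, Am_iso n (a + 1)⟩
      rw [e1] at x1; rw [e2] at x2
      exact x1 x2
  · intro hle
    have key : ∀ A m, m ≤ n → Iso A (copies (2 ^ (n - m)) (cycleD (2 ^ m))) →
        readN (advRunN (qry k) A k) = m := by
      intro A m hm hi
      rw [run_iso (qry k) A (Am n m) hi, upper n k m hm hle k le_rfl]
      simp
    refine ⟨qry k, {l | Even (readN l)}, ?_, ?_⟩
    · rintro A ⟨m, hm, he, hi⟩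
      change Even (readN _)
      rwa [key A m hm hi]
    · rintro A ⟨m, hm, ho, hi⟩
      change ¬ Even (readN _)
      rwa [key A m hm hi, Nat.not_even_iff_odd]
end
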